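/- Let k be a field, X an integral scheme of finite type over k admitting a locally closed immersion into some projective space ℙⁿ_k, and G a nonempty set of dominant k-morphisms X → X closed under composition. Then there exist a countable subset H ⊆ G closed under composition, a dense open subscheme X₀ ⊆ X, and a countable collection (Wᵢ)_{i≥1} of proper closed subsets of X₀, each H-invariant, with the following property: for every field extension F/k and every F-point x : Spec F → X that factors through X₀ and whose image avoids every Wᵢ, the Zariski closures in X_F = X ×_{Spec k} Spec F of the orbits {g ∘ x : g ∈ G} and {h ∘ x : h ∈ H} coincide. -/

import Mathlib

universe u

open AlgebraicGeometry CategoryTheory CategoryTheory.Limits MvPolynomial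

attribute [local instance] MvPolynomial.gradedAlgebra

noncomputable section

/-- Projective `n`-space over the field `k`. -/
def ProjectiveSpace (k : Type u) [Field k] (n : ℕ) : Scheme.{u} :=
  Proj (homogeneousSubmodule (Fin n) k)

/-- The structure morphism `ℙⁿ_k ⟶ Spec k`. -/
def projectiveSpaceStruct (k : Type u) [Field k] (n : ℕ) :
    ProjectiveSpace k n ⟶ Spec (CommRingCat.of k) :=
  Proj.toSpecZero _ ≫ Spec.map (CommRingCat.ofHom (algebraMap k _))

/-- A scheme `X` over `k` is quasi-projective if it admits a locally closed immersion into
some projective space `ℙⁿ_k` over `k`. -/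
def IsQuasiProjectiveOver {k : Type u} [Field k] (X : Scheme.{u})
    (sX : X ⟶ Spec (CommRingCat.of k)) : Prop :=
  ∃ (n : ℕ) (ι : X ⟶ ProjectiveSpace k n), IsImmersion ι ∧ ι ≫ projectiveSpaceStruct k n = sX

/-- The structure morphism `Spec F ⟶ Spec k` of a field extension `F/k`. -/
def specOver (k : Type u) [Field k] (F : Type u) [Field F] [Algebra k F] :
    Spec (CommRingCat.of F) ⟶ Spec (CommRingCat.of k) :=
  Spec.map (CommRingCat.ofHom (algebraMap k F))

/-- The `G`-orbit `{g ∘ x : g ∈ G}` of an `F`-point `x : Spec F ⟶ X`, viewed as a set of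
points of the base change `X_F = X ×_{Spec k} Spec F`. -/
def orbitInBaseChange {k : Type u} [Field k] (X : Scheme.{u})
    (sX : X ⟶ Spec (CommRingCat.of k)) (G : Set (X ⟶ X))
    (F : Type u) [Field F] [Algebra k F] (x : Spec (CommRingCat.of F) ⟶ X) :
    Set (pullback sX (specOver k F) : Scheme.{u}) :=
  { p | ∃ g ∈ G, ∃ w : Spec (CommRingCat.of F) ⟶ pullback sX (specOver k F),
      w ≫ pullback.fst sX (specOver k F) = x ≫ g ∧
      w ≫ pullback.snd sX (specOver k F) = 𝟙 _ ∧
      p ∈ Set.range w.base }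

/-- A linear combination of columns that vanishes on the rows of a nonvanishing minor of maximal
size vanishes on every other row. -/
theorem Matrix.sum_mul_eq_zero_of_det_fromBlocks_eq_zero {K n ι : Type*} [Field K] [Fintype n]
    [DecidableEq n] (s : Finset ι) (c : ι → K) (A : n → ι → K) (b : ι → K) (v : n → ι)
    (hdet : (Matrix.of fun a j ↦ A a (v j)).det ≠ 0)
    (hbord : ∀ j ∈ s, (Matrix.fromBlocks (Matrix.of fun a l ↦ A a (v l))
      (Matrix.of fun a (_ : Unit) ↦ A a j) (Matrix.of fun (_ : Unit) l ↦ b (v l))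
      (Matrix.of fun (_ _ : Unit) ↦ b j)).det = 0)
    (hA : ∀ a, ∑ j ∈ s, c j * A a j = 0) : ∑ j ∈ s, c j * b j = 0 := by
  set M : Matrix n n K := Matrix.of fun a l ↦ A a (v l)
  have : Invertible M := Matrix.invertibleOfIsUnitDet M hdet.isUnit
  have key : ∀ j ∈ s, b j = ∑ a, (∑ l, b (v l) * (⅟M) l a) * A a j := fun j hj ↦ by
    have h := hbord j hj
    rw [Matrix.det_fromBlocks₁₁, mul_eq_zero, or_iff_right hdet, Matrix.det_unique,
      Matrix.sub_apply, sub_eq_zero] at h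
    simpa [Matrix.mul_apply] using h
  calc ∑ j ∈ s, c j * b j
      = ∑ j ∈ s, ∑ a, (∑ l, b (v l) * (⅟M) l a) * (c j * A a j) :=
        Finset.sum_congr rfl fun j hj ↦ by
          rw [key j hj, Finset.mul_sum]
          exact Finset.sum_congr rfl fun a _ ↦ by ring
    _ = 0 := by
        rw [Finset.sum_comm]
        simp [← Finset.mul_sum, hA]

theorem Submonoid.exists_countable_mul_closed {M : Type*} [Monoid M] {S T : Set M}
    (hS : S.Countable) (hST : S ⊆ T) (hT : ∀ a ∈ T, ∀ b ∈ T, a * b ∈ T) :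
    ∃ H : Set M, S ⊆ H ∧ H ⊆ T ∧ H.Countable ∧ ∀ a ∈ H, ∀ b ∈ H, a * b ∈ H := by
  have hc : (Submonoid.closure S : Set M).Countable := by
    have : Countable S := hS.to_subtype
    have : Countable (FreeMonoid S) := inferInstanceAs (Countable (List S))
    rw [Submonoid.closure_eq_mrange, MonoidHom.coe_mrange]
    exact Set.countable_range _
  exact ⟨Submonoid.closure S ∩ T, fun s hs ↦ ⟨Submonoid.subset_closure hs, hST hs⟩,
    Set.inter_subset_right, hc.mono Set.inter_subset_left,
    fun a ha b hb ↦ ⟨mul_mem ha.1 hb.1, hT a ha.2 b hb.2⟩⟩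

theorem Algebra.FiniteType.exists_nat_span_eq_top (R S : Type*) [CommRing R] [CommRing S]
    [Algebra R S] [Algebra.FiniteType R S] :
    ∃ v : ℕ → S, Submodule.span R (Set.range v) = ⊤ := by
  obtain ⟨n, f, hf⟩ := Algebra.FiniteType.iff_quotient_mvPolynomial''.1 ‹Algebra.FiniteType R S›
  obtain ⟨e, he⟩ := exists_surjective_nat (Fin n →₀ ℕ)
  refine ⟨fun m ↦ f (monomial (e m) 1), ?_⟩
  have h : Set.range (fun m ↦ f (monomial (e m) (1 : R))) =
      f.toLinearMap '' Set.range (MvPolynomial.basisMonomials (Fin n) R) := by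
    rw [← he.range_comp, ← Set.range_comp]
    ext; simp
  rw [h, Submodule.span_image, Module.Basis.span_eq, Submodule.map_top, LinearMap.range_eq_top]
  exact hf

open scoped TensorProduct in
theorem TensorProduct.exists_finsupp_sum_tmul {R S F ι : Type*} [CommRing R] [AddCommGroup S]
    [Module R S] [AddCommGroup F] [Module R F] {v : ι → S}
    (hv : Submodule.span R (Set.range v) = ⊤) (f : S ⊗[R] F) :
    ∃ c : ι →₀ F, f = c.sum fun j a ↦ v j ⊗ₜ[R] a := by
  classical
  induction f with
  | zero => exact ⟨0, by simp⟩
  | add x y hx hy =>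
    obtain ⟨c, rfl⟩ := hx
    obtain ⟨d, rfl⟩ := hy
    exact ⟨c + d, (Finsupp.sum_add_index' (by simp) fun j ↦ TensorProduct.tmul_add (v j)).symm⟩
  | tmul s a =>
    obtain ⟨c, rfl⟩ := Finsupp.mem_span_range_iff_exists_finsupp.1 (hv ▸ Submodule.mem_top (x := s))
    refine ⟨c.mapRange (fun r ↦ r • a) (by simp), ?_⟩
    rw [Finsupp.sum_mapRange_index (by simp), Finsupp.sum, Finsupp.sum, TensorProduct.sum_tmul]
    simp [TensorProduct.smul_tmul]

namespace AlgebraicGeometry.Scheme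

variable {X Y : Scheme.{u}} {F : Type u} [Field F]

/-- Evaluation of the sections over `U` at an `F`-point of `U`. -/
def evalPoint (y : Spec (.of F) ⟶ X) (U : X.Opens) (hy : ⊤ ≤ y ⁻¹ᵁ U) :
    Γ(X, U) ⟶ CommRingCat.of F :=
  y.appLE U ⊤ hy ≫ (ΓSpecIso (.of F)).hom

theorem evalPoint_congr {y y' : Spec (.of F) ⟶ X} (h : y = y') (U : X.Opens)
    (hy : ⊤ ≤ y ⁻¹ᵁ U) : evalPoint y U hy = evalPoint y' U (h ▸ hy) := by
  subst h
  rfl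

theorem top_le_preimage_iff (y : Spec (.of F) ⟶ X) (U : X.Opens) (p : Spec (.of F)) :
    ⊤ ≤ y ⁻¹ᵁ U ↔ y p ∈ U := by
  have : Subsingleton (Spec (.of F)) := inferInstanceAs (Subsingleton (PrimeSpectrum F))
  exact ⟨fun h ↦ h trivial, fun h q _ ↦ Subsingleton.elim p q ▸ h⟩

theorem evalPoint_ne_zero_iff (y : Spec (.of F) ⟶ X) (U : X.Opens) (hy : ⊤ ≤ y ⁻¹ᵁ U)
    (s : Γ(X, U)) (p : Spec (.of F)) : evalPoint y U hy s ≠ 0 ↔ y p ∈ X.basicOpen s := by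
  have h := basicOpen_appLE y ⊤ U hy s
  rw [top_inf_eq] at h
  rw [← top_le_preimage_iff, ← h, top_le_iff, evalPoint, CommRingCat.comp_apply]
  have hiso := ConcreteCategory.bijective_of_isIso (ΓSpecIso (.of F)).hom
  constructor
  · intro H
    exact basicOpen_of_isUnit _
      ((MulEquiv.isUnit_map (ΓSpecIso (.of F)).commRingCatIsoToRingEquiv).1 H.isUnit)
  · intro H h0
    rw [← map_zero (ΓSpecIso (.of F)).hom.hom] at h0
    rw [hiso.1 h0, basicOpen_zero] at H
    exact (H.ge trivial : p ∈ (⊥ : (Spec (.of F)).Opens))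

theorem evalPoint_comp (y : Spec (.of F) ⟶ X) (g : X ⟶ Y) (U : X.Opens) (V : Y.Opens)
    (hy : ⊤ ≤ y ⁻¹ᵁ U) (hg : U ≤ g ⁻¹ᵁ V) :
    g.appLE V U hg ≫ evalPoint y U hy =
      evalPoint (y ≫ g) V (hy.trans (y.preimage_mono hg)) := by
  rw [evalPoint, evalPoint, Hom.appLE_comp_appLE_assoc]

theorem SpecMap_evalPoint_fromSpec (y : Spec (.of F) ⟶ X) {U : X.Opens} (hU : IsAffineOpen U)
    (hy : ⊤ ≤ y ⁻¹ᵁ U) : Spec.map (evalPoint y U hy) ≫ hU.fromSpec = y := by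
  rw [evalPoint, Spec.map_comp, Category.assoc,
    IsAffineOpen.SpecMap_appLE_fromSpec y hU (isAffineOpen_top _), IsAffineOpen.fromSpec_top]
  simp [isoSpec_Spec]

/-- The matrix of values of the sections `v` at the translates of an `F`-point by the
endomorphisms `h` is defined and has nonzero determinant. -/
def MinorNeZero {n : Type*} [Fintype n] [DecidableEq n] (y : Spec (.of F) ⟶ X) (U : X.Opens)
    (h : n → (X ⟶ X)) (v : n → Γ(X, U)) : Prop :=
  ∃ e : ∀ a, ⊤ ≤ (y ≫ h a) ⁻¹ᵁ U,
    (Matrix.of fun a b ↦ evalPoint (y ≫ h a) U (e a) (v b)).det ≠ 0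

theorem MinorNeZero.comp_equiv {m n : Type*} [Fintype n] [DecidableEq n] [Fintype m]
    [DecidableEq m] {y : Spec (.of F) ⟶ X} {U : X.Opens} {h : n → (X ⟶ X)} {v : n → Γ(X, U)}
    (H : MinorNeZero y U h v) (e : m ≃ n) : MinorNeZero y U (h ∘ e) (v ∘ e) := by
  obtain ⟨e₁, H⟩ := H
  refine ⟨fun a ↦ e₁ (e a), ?_⟩
  rwa [← Matrix.det_submatrix_equiv_self e] at H

/-- The open locus where the minor with rows `h` and columns `v` is defined and does not vanish. -/
def minorLocus {n : Type*} [Fintype n] [DecidableEq n] (U : X.Opens) (h : n → (X ⟶ X))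
    (v : n → Γ(X, U)) : X.Opens :=
  X.basicOpen (Matrix.of fun a b ↦
    (h a).appLE U (⨅ a, h a ⁻¹ᵁ U) (iInf_le (fun a ↦ h a ⁻¹ᵁ U) a) (v b)).det

theorem minorNeZero_iff_mem_minorLocus {n : Type*} [Fintype n] [DecidableEq n]
    (y : Spec (.of F) ⟶ X) (p : Spec (.of F)) (U : X.Opens) (h : n → (X ⟶ X))
    (v : n → Γ(X, U)) : MinorNeZero y U h v ↔ y p ∈ minorLocus U h v := by
  let O : X.Opens := ⨅ a, h a ⁻¹ᵁ U
  have hO (a : n) : O ≤ h a ⁻¹ᵁ U := iInf_le _ a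
  let M : Matrix n n Γ(X, O) := Matrix.of fun a b ↦ (h a).appLE U O (hO a) (v b)
  change _ ↔ y p ∈ X.basicOpen M.det
  have key (e : ⊤ ≤ y ⁻¹ᵁ O) : evalPoint y O e M.det = (Matrix.of fun a b ↦
      evalPoint (y ≫ h a) U (e.trans (y.preimage_mono (hO a))) (v b)).det := by
    change (evalPoint y O e).hom M.det = _
    rw [RingHom.map_det]
    congr 1
    ext a b
    simp only [RingHom.mapMatrix_apply, Matrix.map_apply, Matrix.of_apply, M,
      ← evalPoint_comp _ _ _ _ e (hO a)]
    rfl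
  constructor
  · rintro ⟨e, H⟩
    have e' : ⊤ ≤ y ⁻¹ᵁ O := by
      rw [top_le_preimage_iff y _ p, ← SetLike.mem_coe, TopologicalSpace.Opens.coe_iInf,
        Set.mem_iInter]
      exact fun a ↦ e a trivial
    rwa [← evalPoint_ne_zero_iff y O e', key e']
  · intro H
    have e' := (top_le_preimage_iff y O p).2 (X.basicOpen_le _ H)
    refine ⟨fun a ↦ e'.trans (y.preimage_mono (hO a)), ?_⟩
    rwa [← evalPoint_ne_zero_iff y O e', key e'] at H

theorem exists_spec_field_map_eq (p : X) :
    ∃ (F : Type u) (_ : Field F) (y : Spec (.of F) ⟶ X) (q : Spec (.of F)), y q = p := by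
  obtain ⟨q, hq⟩ := (X.range_fromSpecResidueField p).ge rfl
  exact ⟨X.residueField p, inferInstance, X.fromSpecResidueField p, q, hq⟩

theorem map_mem_minorLocus_iff {n : Type*} [Fintype n] [DecidableEq n] (p : X) (g : X ⟶ X)
    (U : X.Opens) (h : n → (X ⟶ X)) (v : n → Γ(X, U)) :
    g p ∈ minorLocus U h v ↔ p ∈ minorLocus U (fun a ↦ g ≫ h a) v := by
  obtain ⟨F, _, y, q, rfl⟩ := exists_spec_field_map_eq p
  rw [← Hom.comp_apply, ← minorNeZero_iff_mem_minorLocus, ← minorNeZero_iff_mem_minorLocus]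
  simp only [MinorNeZero, Category.assoc]

theorem MinorNeZero.injective {n : Type*} [Fintype n] [DecidableEq n] {y : Spec (.of F) ⟶ X}
    {U : X.Opens} {h : n → (X ⟶ X)} {v : n → Γ(X, U)} (H : MinorNeZero y U h v) :
    Function.Injective v := by
  obtain ⟨e, H⟩ := H
  intro a b hab
  by_contra hne
  exact H (Matrix.det_zero_of_column_eq hne fun i ↦ by simp [hab])

/-- If the values at `y` of the translates `h a` form a nonvanishing minor of maximal size, then
a linear combination of sections vanishing at the points `y ≫ h a` vanishes at `y ≫ g`. -/
theorem MinorNeZero.sum_evalPoint_eq_zero {ι n : Type*} [Fintype n] [DecidableEq n]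
    {y : Spec (.of F) ⟶ X} {U : X.Opens} {h : n → (X ⟶ X)} {v : ι → Γ(X, U)} {l : n → ι}
    (H : MinorNeZero y U h (v ∘ l)) {g : X ⟶ X} (hg : ⊤ ≤ (y ≫ g) ⁻¹ᵁ U) (s : Finset ι)
    (hmax : ∀ j ∈ s, ¬ MinorNeZero y U (Sum.elim h fun _ : Unit ↦ g)
      (v ∘ Sum.elim l fun _ : Unit ↦ j))
    (c : ι → F) (hc : ∀ a (e : ⊤ ≤ (y ≫ h a) ⁻¹ᵁ U),
      ∑ j ∈ s, c j * evalPoint (y ≫ h a) U e (v j) = 0) :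
    ∑ j ∈ s, c j * evalPoint (y ≫ g) U hg (v j) = 0 := by
  obtain ⟨e, H⟩ := H
  refine Matrix.sum_mul_eq_zero_of_det_fromBlocks_eq_zero s c
    (fun a j ↦ evalPoint (y ≫ h a) U (e a) (v j)) (fun j ↦ evalPoint (y ≫ g) U hg (v j)) l H
    (fun j hj ↦ ?_) fun a ↦ hc a (e a)
  by_contra hne
  refine hmax j hj ⟨Sum.rec e fun _ ↦ hg, ?_⟩
  convert hne using 2
  ext (a | a) (b | b) <;> rfl

section BaseChange

variable {k : Type u} [Field k] (sX : X ⟶ Spec (CommRingCat.of k)) [Algebra k F]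

open scoped TensorProduct in
/-- An `F`-rational point of `X_F` over an affine open `U ⊆ X` lies in the closure of a family of
`F`-rational points as soon as every `F`-linear combination of sections over `U` vanishing on the
family vanishes at the point. -/
theorem mem_closure_of_forall_sum_evalPoint_eq_zero {U : X.Opens} (hU : IsAffineOpen U)
    {ι : Type*} (v : ι → Γ(X, U))
    (hv : letI := (Spec.preimage (hU.fromSpec ≫ sX)).hom.toAlgebra
      Submodule.span k (Set.range v) = ⊤)
    (A : Set (Spec (.of F) ⟶ pullback sX (specOver k F)))
    (hA : ∀ w ∈ A, w ≫ pullback.snd _ _ = 𝟙 _)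
    (w : Spec (.of F) ⟶ pullback sX (specOver k F)) (hw : w ≫ pullback.snd _ _ = 𝟙 _)
    (hwU : ⊤ ≤ (w ≫ pullback.fst _ _) ⁻¹ᵁ U)
    (H : ∀ c : ι →₀ F, (∀ w' ∈ A, ∀ e : ⊤ ≤ (w' ≫ pullback.fst _ _) ⁻¹ᵁ U,
        ∑ j ∈ c.support, c j * evalPoint (w' ≫ pullback.fst _ _) U e (v j) = 0) →
      ∑ j ∈ c.support, c j * evalPoint (w ≫ pullback.fst _ _) U hwU (v j) = 0)
    (p : Spec (.of F)) :
    w p ∈ closure {q | ∃ w' ∈ A, q ∈ Set.range w'} := by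
  let := (Spec.preimage (hU.fromSpec ≫ sX)).hom.toAlgebra
  have hφ : Spec.map (CommRingCat.ofHom (algebraMap k Γ(X, U))) = hU.fromSpec ≫ sX :=
    Spec.map_preimage (hU.fromSpec ≫ sX)
  let B := Γ(X, U) ⊗[k] F
  let j : Spec (.of B) ⟶ pullback sX (specOver k F) :=
    pullback.lift (Spec.map (CommRingCat.ofHom Algebra.TensorProduct.includeLeftRingHom) ≫
        hU.fromSpec)
      (Spec.map (CommRingCat.ofHom
        (Algebra.TensorProduct.includeRight : F →ₐ[k] B).toRingHom)) (by
      rw [Category.assoc, ← hφ, specOver, ← Spec.map_comp, ← Spec.map_comp,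
        ← CommRingCat.ofHom_comp, ← CommRingCat.ofHom_comp]
      congr 2
      ext a
      exact (Algebra.TensorProduct.includeRight : F →ₐ[k] B).commutes a |>.symm)
  have lift (w' : Spec (.of F) ⟶ pullback sX (specOver k F)) (hw' : w' ≫ pullback.snd _ _ = 𝟙 _)
      (e : ⊤ ≤ (w' ≫ pullback.fst _ _) ⁻¹ᵁ U) :
      ∃ ψ : B →+* F, Spec.map (CommRingCat.ofHom ψ) ≫ j = w' ∧
        ∀ s a, ψ (s ⊗ₜ a) = a * evalPoint (w' ≫ pullback.fst _ _) U e s := by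
    have hcomp : CommRingCat.ofHom (algebraMap k Γ(X, U)) ≫ evalPoint _ U e =
        CommRingCat.ofHom (algebraMap k F) := by
      apply Spec.map_injective
      rw [Spec.map_comp, hφ, ← Category.assoc, SpecMap_evalPoint_fromSpec, Category.assoc,
        pullback.condition, reassoc_of% hw']
      rfl
    let ev : Γ(X, U) →ₐ[k] F := ⟨(evalPoint _ U e).hom, fun r ↦
      RingHom.congr_fun (congrArg CommRingCat.Hom.hom hcomp) r⟩
    refine ⟨(Algebra.TensorProduct.productMap ev (AlgHom.id k F)).toRingHom, ?_, fun s a ↦ ?_⟩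
    · apply pullback.hom_ext
      · rw [Category.assoc, pullback.lift_fst, ← Spec.map_comp_assoc, ← CommRingCat.ofHom_comp]
        refine (congrArg (Spec.map · ≫ hU.fromSpec) ?_).trans
          (SpecMap_evalPoint_fromSpec (w' ≫ pullback.fst _ _) hU e)
        refine CommRingCat.hom_ext (RingHom.ext fun s ↦ ?_)
        exact (Algebra.TensorProduct.productMap_apply_tmul ev (AlgHom.id k F) s 1).trans
          (mul_one _)
      · rw [Category.assoc, pullback.lift_snd, ← Spec.map_comp, ← CommRingCat.ofHom_comp, hw',
          ← Spec.map_id]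
        congr 1
        refine CommRingCat.hom_ext (RingHom.ext fun s ↦ ?_)
        exact (Algebra.TensorProduct.productMap_apply_tmul ev (AlgHom.id k F) 1 s).trans
          ((congrArg (· * s) (map_one ev)).trans (one_mul s))
    · exact (Algebra.TensorProduct.productMap_apply_tmul ev (AlgHom.id k F) s a).trans
        (mul_comm _ _)
  have ψ_sum (ψ : B →+* F) (y : Spec (.of F) ⟶ X) (e : ⊤ ≤ y ⁻¹ᵁ U)
      (hψ : ∀ s a, ψ (s ⊗ₜ a) = a * evalPoint y U e s) (c : ι →₀ F) :
      ψ (c.sum fun j a ↦ v j ⊗ₜ[k] a) = ∑ j ∈ c.support, c j * evalPoint y U e (v j) := by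
    simp [Finsupp.sum, hψ]
  have mem_iff (ψ : B →+* F) (f : B) (q : Spec (.of F)) :
      Spec.map (CommRingCat.ofHom ψ) q ∈ PrimeSpectrum.basicOpen f ↔ ψ f ≠ 0 := by
    have hq : (show PrimeSpectrum F from q).asIdeal = ⊥ := (Ideal.eq_bot_or_top _).resolve_right
      (show PrimeSpectrum F from q).2.ne_top
    change ψ f ∉ (show PrimeSpectrum F from q).asIdeal ↔ _
    rw [hq, Ideal.mem_bot]
  obtain ⟨ψ, hψ, hψt⟩ := lift w hw hwU
  by_contra hcl
  set C := closure {q | ∃ w' ∈ A, q ∈ Set.range w'}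
  have hopen : IsOpen (j ⁻¹' Cᶜ) := isClosed_closure.isOpen_compl.preimage j.continuous
  have hmem : Spec.map (CommRingCat.ofHom ψ) p ∈ j ⁻¹' Cᶜ := by
    rwa [Set.mem_preimage, ← Hom.comp_apply, hψ]
  obtain ⟨_, ⟨f, rfl⟩, hpf, hfC⟩ :=
    PrimeSpectrum.isTopologicalBasis_basic_opens.exists_subset_of_mem_open hmem hopen
  obtain ⟨c, rfl⟩ := TensorProduct.exists_finsupp_sum_tmul hv f
  refine (mem_iff ψ _ p).1 hpf ?_
  rw [ψ_sum ψ _ hwU hψt]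
  refine H c fun w' hw'A e ↦ ?_
  obtain ⟨ψ', hψ', hψt'⟩ := lift w' (hA w' hw'A) e
  rw [← ψ_sum ψ' _ e hψt']
  by_contra hne
  refine hfC ((mem_iff ψ' _ p).2 hne) (subset_closure ⟨w', hw'A, ?_⟩)
  rw [← Hom.comp_apply, hψ']
  exact ⟨p, rfl⟩

end BaseChange

/-- Among the minors with rows in `G` and columns in a finite set `J`, some minor of maximal size is
not identically zero. -/
theorem exists_maximal_minor [Nonempty X] {ι : Type*} (G : Set (X ⟶ X)) (U : X.Opens)
    (v : ι → Γ(X, U)) (J : Finset ι) :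
    ∃ (r : ℕ) (h : Fin r → (X ⟶ X)) (l : Fin r → ι), (∀ a, h a ∈ G) ∧ (∀ a, l a ∈ J) ∧
      (minorLocus U h (v ∘ l) : Set X).Nonempty ∧
      ∀ (h' : Fin (r + 1) → (X ⟶ X)) (l' : Fin (r + 1) → ι), (∀ a, h' a ∈ G) → (∀ a, l' a ∈ J) →
        ¬ (minorLocus U h' (v ∘ l') : Set X).Nonempty := by
  classical
  let P (r : ℕ) : Prop := ∃ (h : Fin r → (X ⟶ X)) (l : Fin r → ι), (∀ a, h a ∈ G) ∧
    (∀ a, l a ∈ J) ∧ (minorLocus U h (v ∘ l) : Set X).Nonempty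
  have hP0 : P 0 := by
    obtain ⟨F, _, y, q, -⟩ := exists_spec_field_map_eq (Classical.arbitrary X)
    refine ⟨Fin.elim0, Fin.elim0, fun a ↦ a.elim0, fun a ↦ a.elim0, y q, ?_⟩
    exact (minorNeZero_iff_mem_minorLocus y q _ _ _).1 ⟨fun a ↦ a.elim0, by simp⟩
  have hPle (r : ℕ) (hr : P r) : r ≤ J.card := by
    obtain ⟨h, l, -, hl, p, hp⟩ := hr
    obtain ⟨F, _, y, q, rfl⟩ := exists_spec_field_map_eq p
    have hinj := ((minorNeZero_iff_mem_minorLocus y q _ _ _).2 hp).injective.of_comp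
    simpa using Finset.card_le_card_of_injOn l (s := Finset.univ) (fun a _ ↦ hl a) hinj.injOn
  obtain ⟨h, l, hh, hl, hp⟩ := Nat.findGreatest_spec (P := P) (Nat.zero_le J.card) hP0
  refine ⟨_, h, l, hh, hl, hp, fun h' l' hh' hl' hp' ↦ ?_⟩
  have hP : P (Nat.findGreatest P J.card + 1) := ⟨h', l', hh', hl', hp'⟩
  exact Nat.findGreatest_is_greatest (Nat.lt_succ_self _) (hPle _ hP) hP

end AlgebraicGeometry.Scheme

/-- **A countable subsemigroup controls orbit closures in very general position
(Corollary 6.2(b)).**  Let `k` be a field, `X` an irreducible quasi-projective variety over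
`k`, and `G` a nonempty semigroup of dominant `k`-morphisms `X → X`.  Then there exist a
countable subsemigroup `H ⊆ G`, a dense open `X₀ ⊆ X` and a countable collection `(Wᵢ)` of
proper closed `H`-invariant subsets of `X₀` such that for every field extension `F/k` and
every `F`-point `x` of `X` factoring through `X₀` and avoiding every `Wᵢ`, the `G`-orbit and
the `H`-orbit of `x` have the same Zariski closure in `X_F`. -/
theorem countable_subsemigroup_controls_orbit_closures
    {k : Type u} [Field k]
    (X : Scheme.{u}) (sX : X ⟶ Spec (CommRingCat.of k))
    [IsIntegral X] [LocallyOfFiniteType sX] [QuasiCompact sX]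
    (hqp : IsQuasiProjectiveOver X sX)
    (G : Set (X ⟶ X)) (hGne : G.Nonempty)
    (hGover : ∀ g ∈ G, g ≫ sX = sX)
    (hGdom : ∀ g ∈ G, IsDominant g)
    (hGcomp : ∀ g ∈ G, ∀ g' ∈ G, g ≫ g' ∈ G) :
    ∃ (H : Set (X ⟶ X)) (_ : H ⊆ G) (_ : H.Countable)
      (_ : ∀ h ∈ H, ∀ h' ∈ H, h ≫ h' ∈ H)
      (X₀ : X.Opens) (_ : Dense (X₀ : Set X)) (W : ℕ → Set X),
      -- each `Wᵢ` is a proper closed `H`-invariant subset of `X₀`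
      (∀ i, W i ⊆ (X₀ : Set X)) ∧
      (∀ i, IsClosed (Subtype.val ⁻¹' (W i) : Set (X₀ : Set X))) ∧
      (∀ i, W i ≠ (X₀ : Set X)) ∧
      (∀ i, ∀ h ∈ H, ∀ p ∈ W i, h.base p ∈ W i) ∧
      -- the `G`-orbit and the `H`-orbit of a very general point have the same closure
      (∀ (F : Type u) [Field F] [Algebra k F]
        (x : Spec (CommRingCat.of F) ⟶ X)
        (x₀ : Spec (CommRingCat.of F) ⟶ (X₀ : Scheme.{u})),
        x ≫ sX = specOver k F →
        x₀ ≫ X₀.ι = x →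
        (∀ i, ∀ p ∈ Set.range x.base, p ∉ W i) →
        closure (orbitInBaseChange X sX G F x) =
          closure (orbitInBaseChange X sX H F x)) := by
  have : Nonempty X := inferInstance
  have : CompactSpace X := QuasiCompact.compactSpace_of_compactSpace sX
  let 𝒰 := X.affineCover.finiteSubcover
  have : Finite 𝒰.I₀ := inferInstance
  have hU (i : 𝒰.I₀) : IsAffineOpen (𝒰.f i).opensRange := isAffineOpen_opensRange _
  have hv (i : 𝒰.I₀) : ∃ v : ℕ → Γ(X, (𝒰.f i).opensRange),
      letI := (Spec.preimage ((hU i).fromSpec ≫ sX)).hom.toAlgebra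
      Submodule.span k (Set.range v) = ⊤ := by
    let := (Spec.preimage ((hU i).fromSpec ≫ sX)).hom.toAlgebra
    have : Algebra.FiniteType k Γ(X, (𝒰.f i).opensRange) := by
      refine HasRingHomProperty.Spec_iff (P := @LocallyOfFiniteType)
        (φ := Spec.preimage ((hU i).fromSpec ≫ sX)) |>.1 ?_
      rw [Spec.map_preimage]
      infer_instance
    exact Algebra.FiniteType.exists_nat_span_eq_top k _
  choose v hv using hv
  choose r h l hhG hlJ hne hmax using fun i : 𝒰.I₀ × Finset ℕ ↦
    Scheme.exists_maximal_minor G (𝒰.f i.1).opensRange (v i.1) i.2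
  obtain ⟨H, hSH, hHG, hHc, hHm⟩ := Submonoid.exists_countable_mul_closed (M := End X)
    (S := ⋃ i, Set.range (h i)) (T := G) (Set.countable_iUnion fun i ↦ Set.countable_range _)
    (Set.iUnion_subset fun i ↦ Set.range_subset_iff.2 (hhG i))
    fun a ha b hb ↦ hGcomp b hb a ha
  let D (i : 𝒰.I₀ × Finset ℕ) : Set X := {p | ∃ (g : Fin (r i) → (X ⟶ X)) (m : Fin (r i) → ℕ),
    (∀ a, g a ∈ H) ∧ (∀ a, m a ∈ i.2) ∧
      p ∈ Scheme.minorLocus (𝒰.f i.1).opensRange g (v i.1 ∘ m)}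
  have hDopen (i) : IsOpen (D i) := by
    refine isOpen_iff_forall_mem_open.2 fun p hp ↦ ?_
    obtain ⟨g, m, hg, hm, hp⟩ := hp
    exact ⟨_, fun q hq ↦ ⟨g, m, hg, hm, hq⟩, (Scheme.minorLocus _ g _).2, hp⟩
  have hDne (i) : (D i).Nonempty := by
    obtain ⟨p, hp⟩ := hne i
    exact ⟨p, h i, l i, fun a ↦ hSH (Set.mem_iUnion.2 ⟨i, a, rfl⟩), hlJ i, hp⟩
  have : Nonempty 𝒰.I₀ := ⟨𝒰.idx (Classical.arbitrary X)⟩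
  obtain ⟨e, he⟩ := exists_surjective_nat (𝒰.I₀ × Finset ℕ)
  refine ⟨H, hHG, hHc, fun a ha b hb ↦ hHm b hb a ha, ⊤, dense_univ, fun n ↦ (D (e n))ᶜ,
    fun _ ↦ Set.subset_univ _, fun n ↦ (hDopen _).isClosed_compl.preimage continuous_subtype_val,
    fun n hn ↦ ?_, fun n g hg p hp hgp ↦ ?_, fun F _ _ x _ hx _ hxW ↦ ?_⟩
  · exact (hDne (e n)).ne_empty (compl_eq_top.1 hn)
  · obtain ⟨g', m, hg', hm, hgp⟩ := hgp
    exact hp ⟨fun a ↦ g ≫ g' a, m, fun a ↦ hHm _ (hg' a) _ hg, hm,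
      (Scheme.map_mem_minorLocus_iff ..).1 hgp⟩
  refine subset_antisymm (closure_minimal ?_ isClosed_closure) (closure_mono ?_)
  swap
  · rintro p ⟨g, hg, hp⟩
    exact ⟨g, hHG hg, hp⟩
  rintro _ ⟨g, hg, w, hw, hw', q, rfl⟩
  let i := 𝒰.idx ((x ≫ g) q)
  have hwU : ⊤ ≤ (w ≫ pullback.fst _ _) ⁻¹ᵁ (𝒰.f i).opensRange := by
    rw [hw, Scheme.top_le_preimage_iff _ _ q]
    exact 𝒰.covers ((x ≫ g) q)
  have key := Scheme.mem_closure_of_forall_sum_evalPoint_eq_zero sX (hU i) (v i) (hv i)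
    {w' | w' ≫ pullback.snd _ _ = 𝟙 _ ∧ ∃ g' ∈ H, w' ≫ pullback.fst _ _ = x ≫ g'}
    (fun w' h ↦ h.1) w hw' hwU (fun c hc ↦ ?_) q
  · refine closure_mono ?_ key
    rintro p ⟨w', ⟨h₁, g', hg', h₂⟩, hp⟩
    exact ⟨g', hg', w', h₂, h₁, hp⟩
  obtain ⟨n, hn⟩ := he (i, c.support)
  have hxD := not_not.1 (hxW n (x q) ⟨q, rfl⟩)
  rw [hn] at hxD
  obtain ⟨g', m, hg', hm, hxm⟩ := hxD
  have hxm' := (Scheme.minorNeZero_iff_mem_minorLocus x q _ _ _).2 hxm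
  have hwU' := hwU
  rw [hw] at hwU'
  have main := hxm'.sum_evalPoint_eq_zero hwU' c.support (fun j hj hmin ↦ ?_) c fun a ea ↦ ?_
  · simpa only [Scheme.evalPoint_congr hw] using main
  · let E : Fin (r (i, c.support) + 1) ≃ Fin (r (i, c.support)) ⊕ Unit :=
      finSumFinEquiv.symm.trans (Equiv.sumCongr (Equiv.refl _) (Equiv.equivPUnit (Fin 1)))
    have hG' : ∀ b, Sum.elim g' (fun _ : Unit ↦ g) b ∈ G :=
      Sum.rec (fun b ↦ hHG (hg' b)) fun _ ↦ hg
    have hJ' : ∀ b, Sum.elim m (fun _ : Unit ↦ j) b ∈ c.support := Sum.rec hm fun _ ↦ hj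
    exact hmax (i, c.support) (Sum.elim g' (fun _ ↦ g) ∘ E) (Sum.elim m (fun _ ↦ j) ∘ E)
      (fun a ↦ hG' (E a)) (fun a ↦ hJ' (E a))
      ⟨x q, (Scheme.minorNeZero_iff_mem_minorLocus x q _ _ _).1 (hmin.comp_equiv E)⟩
  · let w' : Spec (.of F) ⟶ pullback sX (specOver k F) := pullback.lift (x ≫ g' a) (𝟙 _) (by
      rw [Category.assoc, hGover _ (hHG (hg' a)), hx, Category.id_comp])
    have hw'x : w' ≫ pullback.fst _ _ = x ≫ g' a := pullback.lift_fst ..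
    have := hc w' ⟨pullback.lift_snd .., g' a, hg' a, hw'x⟩ (by rwa [hw'x])
    simpa only [Scheme.evalPoint_congr hw'x] using this

end
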